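/- Fix n ≥ 1, T ≥ 1, v ∈ ℝ^{n×T}, and λ₁, λ₂ ≥ 0. For a matrix θ ∈ ℝ^{n×T} (columns θ_{·,1}, …, θ_{·,T}), define f_{λ₁,λ₂}(θ) = (1/2)‖θ − v‖₂² + λ₁‖θ‖₁ + λ₂ Σ_{t=2}^{T} ‖θ_{·,t} − θ_{·,t−1}‖₁, where ‖·‖₂ is the Euclidean (Frobenius) norm on ℝ^{n×T} and ‖·‖₁ sums absolute values of entries. Let θ̂(λ₁, λ₂) denote the unique minimizer of f_{λ₁,λ₂} (which exists since f is strictly convex and coercive). Then for every entry (i, t), θ̂(λ₁, λ₂)_{i,t} = sign(θ̂(0, λ₂)_{i,t}) · max(|θ̂(0, λ₂)_{i,t}| − λ₁, 0); that is, θ̂(λ₁, λ₂) is obtained from θ̂(0, λ₂) by entrywise soft-thresholding at level λ₁. -/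

import Mathlib

open Finset

/-- The fused LASSO signal approximator objective
`f_{λ₁,λ₂}(θ) = (1/2)‖θ − v‖₂² + λ₁‖θ‖₁ + λ₂ Σ_{t=2}^{T} ‖θ_{·,t} − θ_{·,t−1}‖₁`,
for `θ, v ∈ ℝ^{n×T}` (entries `θ i t`, columns indexed by `t`). -/
noncomputable def fusedLassoObj (n T : ℕ) (v : Fin n → Fin T → ℝ) (lam₁ lam₂ : ℝ)
    (θ : Fin n → Fin T → ℝ) : ℝ :=
  (1 / 2) * (∑ i, ∑ t, (θ i t - v i t) ^ 2)
    + lam₁ * (∑ i, ∑ t, |θ i t|)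
    + lam₂ * ∑ t ∈ Finset.univ.filter (fun t : Fin T => (t : ℕ) ≠ 0),
        ∑ i, |θ i t - θ i ⟨(t : ℕ) - 1, lt_of_le_of_lt (Nat.sub_le _ _) t.isLt⟩|

/-- Soft-thresholding of a real number `a` at level `l`. -/
noncomputable def softThreshold (l a : ℝ) : ℝ := Real.sign a * max (|a| - l) 0

theorem softThreshold_cases {l : ℝ} (hl : 0 ≤ l) (a : ℝ) :
    (l ≤ a ∧ softThreshold l a = a - l) ∨ (a ≤ -l ∧ softThreshold l a = a + l) ∨
      (|a| ≤ l ∧ softThreshold l a = 0) := by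
  unfold softThreshold
  rcases le_or_gt |a| l with h | h
  · exact Or.inr (Or.inr ⟨h, by rw [max_eq_right (by linarith), mul_zero]⟩)
  · rw [max_eq_left (by linarith)]
    rcases lt_trichotomy a 0 with ha | ha | ha
    · rw [abs_of_neg ha] at h ⊢
      rw [Real.sign_of_neg ha]
      exact Or.inr (Or.inl ⟨by linarith, by ring⟩)
    · rw [ha, abs_zero] at h
      linarith
    · rw [abs_of_pos ha] at h ⊢
      rw [Real.sign_of_pos ha]
      exact Or.inl ⟨h.le, by ring⟩

theorem abs_sub_softThreshold_le {l : ℝ} (hl : 0 ≤ l) (a : ℝ) :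
    |a - softThreshold l a| ≤ l := by
  rcases softThreshold_cases hl a with ⟨h, e⟩ | ⟨h, e⟩ | ⟨h, e⟩ <;> rw [e] <;> grind

theorem sub_softThreshold_mul_self {l : ℝ} (hl : 0 ≤ l) (a : ℝ) :
    (a - softThreshold l a) * softThreshold l a = l * |softThreshold l a| := by
  rcases softThreshold_cases hl a with ⟨h, e⟩ | ⟨h, e⟩ | ⟨h, e⟩ <;> rw [e]
  · rw [abs_of_nonneg (by linarith)]; ring
  · rw [abs_of_nonpos (by linarith)]; ring
  · simp

theorem abs_sub_eq_softThreshold_add {l : ℝ} (hl : 0 ≤ l) (a b : ℝ) :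
    |a - b| = |softThreshold l a - softThreshold l b|
      + |(a - softThreshold l a) - (b - softThreshold l b)| := by
  rcases softThreshold_cases hl a with ⟨h, e⟩ | ⟨h, e⟩ | ⟨h, e⟩ <;>
  rcases softThreshold_cases hl b with ⟨h', e'⟩ | ⟨h', e'⟩ | ⟨h', e'⟩ <;>
  rw [e, e'] <;> grind

/-- The sum of the `ℓ₁` norms of successive column differences. -/
noncomputable def columnVariation {n T : ℕ} (θ : Fin n → Fin T → ℝ) : ℝ :=
  ∑ t ∈ Finset.univ.filter (fun t : Fin T => (t : ℕ) ≠ 0),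
    ∑ i, |θ i t - θ i ⟨(t : ℕ) - 1, lt_of_le_of_lt (Nat.sub_le _ _) t.isLt⟩|

theorem columnVariation_add_le {n T : ℕ} (x y : Fin n → Fin T → ℝ) :
    columnVariation (x + y) ≤ columnVariation x + columnVariation y := by
  simp only [columnVariation, ← Finset.sum_add_distrib]
  refine Finset.sum_le_sum fun t _ => Finset.sum_le_sum fun i _ => ?_
  simp only [Pi.add_apply, add_sub_add_comm]
  exact abs_add_le _ _

theorem columnVariation_smul {n T : ℕ} {c : ℝ} (hc : 0 ≤ c) (x : Fin n → Fin T → ℝ) :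
    columnVariation (c • x) = c * columnVariation x := by
  simp only [columnVariation, Finset.mul_sum, Pi.smul_apply, smul_eq_mul, ← mul_sub, abs_mul,
    abs_of_nonneg hc]

theorem columnVariation_eq_softThreshold_add {n T : ℕ} {l : ℝ} (hl : 0 ≤ l)
    (x : Fin n → Fin T → ℝ) :
    columnVariation x = columnVariation (fun i t => softThreshold l (x i t))
      + columnVariation (fun i t => x i t - softThreshold l (x i t)) := by
  simp only [columnVariation, ← Finset.sum_add_distrib]
  exact Finset.sum_congr rfl fun t _ => Finset.sum_congr rfl fun i _ =>
    abs_sub_eq_softThreshold_add hl _ _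

theorem nonneg_of_forall_mul_add_nonneg {a b : ℝ}
    (h : ∀ ε : ℝ, 0 < ε → ε ≤ 1 → 0 ≤ ε * a + b) : 0 ≤ b := by
  refine le_of_forall_pos_le_add fun δ hδ => ?_
  have hε : 0 < min 1 (δ / (|a| + 1)) := by positivity
  have h₁ := h _ hε (min_le_left _ _)
  have h₂ : min 1 (δ / (|a| + 1)) * (|a| + 1) ≤ δ :=
    (le_div_iff₀ (by positivity)).1 (min_le_right _ _)
  nlinarith [mul_le_mul_of_nonneg_left (le_abs_self a) hε.le]

theorem fusedLassoObj_add {n T : ℕ} (v : Fin n → Fin T → ℝ) (l m : ℝ)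
    (x y : Fin n → Fin T → ℝ) :
    fusedLassoObj n T v l m (x + y) = (1 / 2) * (∑ i, ∑ t, (x i t - v i t) ^ 2)
      + (1 / 2) * (∑ i, ∑ t, y i t ^ 2) - (∑ i, ∑ t, (v i t - x i t) * y i t)
      + l * (∑ i, ∑ t, |x i t + y i t|) + m * columnVariation (x + y) := by
  have h : (1 / 2) * (∑ i, ∑ t, ((x + y) i t - v i t) ^ 2)
      = (1 / 2) * (∑ i, ∑ t, (x i t - v i t) ^ 2)
      + (1 / 2) * (∑ i, ∑ t, y i t ^ 2) - (∑ i, ∑ t, (v i t - x i t) * y i t) := by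
    simp only [Finset.mul_sum, ← Finset.sum_add_distrib, ← Finset.sum_sub_distrib]
    refine Finset.sum_congr rfl fun i _ => Finset.sum_congr rfl fun t _ => ?_
    simp only [Pi.add_apply]
    ring
  rw [← h]
  rfl

theorem fusedLassoObj_eq {n T : ℕ} (v : Fin n → Fin T → ℝ) (l m : ℝ)
    (x : Fin n → Fin T → ℝ) :
    fusedLassoObj n T v l m x = (1 / 2) * (∑ i, ∑ t, (x i t - v i t) ^ 2)
      + l * (∑ i, ∑ t, |x i t|) + m * columnVariation x := rfl

section Minimizer

variable {n T : ℕ} {v x : Fin n → Fin T → ℝ} {m : ℝ}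

theorem sum_smul_sq (c : ℝ) (y : Fin n → Fin T → ℝ) :
    ∑ i, ∑ t, (c • y) i t ^ 2 = c ^ 2 * ∑ i, ∑ t, y i t ^ 2 := by
  simp only [Pi.smul_apply, smul_eq_mul, mul_pow, Finset.mul_sum]

theorem sum_mul_smul (c : ℝ) (g y : Fin n → Fin T → ℝ) :
    ∑ i, ∑ t, g i t * (c • y) i t = c * ∑ i, ∑ t, g i t * y i t := by
  simp only [Pi.smul_apply, smul_eq_mul, Finset.mul_sum, mul_left_comm]

theorem residual_inner_le (hm : 0 ≤ m)
    (hx : ∀ θ, fusedLassoObj n T v 0 m x ≤ fusedLassoObj n T v 0 m θ)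
    (y : Fin n → Fin T → ℝ) :
    ∑ i, ∑ t, (v i t - x i t) * y i t ≤ m * columnVariation y := by
  rw [← sub_nonneg]
  refine nonneg_of_forall_mul_add_nonneg (a := (1 / 2) * ∑ i, ∑ t, y i t ^ 2)
    fun ε hε _ => ?_
  have h := hx (x + ε • y)
  rw [fusedLassoObj_add, fusedLassoObj_eq, sum_smul_sq,
    sum_mul_smul ε (fun i t => v i t - x i t) y] at h
  have h' := mul_le_mul_of_nonneg_left (columnVariation_add_le x (ε • y)) hm
  rw [columnVariation_smul hε.le] at h'
  refine nonneg_of_mul_nonneg_right (a := ε) ?_ hε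
  nlinarith

theorem le_residual_inner_self
    (hx : ∀ θ, fusedLassoObj n T v 0 m x ≤ fusedLassoObj n T v 0 m θ) :
    m * columnVariation x ≤ ∑ i, ∑ t, (v i t - x i t) * x i t := by
  rw [← sub_nonneg]
  refine nonneg_of_forall_mul_add_nonneg (a := (1 / 2) * ∑ i, ∑ t, x i t ^ 2)
    fun ε hε hε' => ?_
  have h := hx (x + (-ε) • x)
  have hs : x + (-ε) • x = (1 - ε) • x := by module
  rw [fusedLassoObj_add, fusedLassoObj_eq, sum_smul_sq,
    sum_mul_smul (-ε) (fun i t => v i t - x i t) x, hs,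
    columnVariation_smul (sub_nonneg.2 hε')] at h
  refine nonneg_of_mul_nonneg_right (a := ε) ?_ hε
  nlinarith

theorem le_residual_inner_softThreshold (hm : 0 ≤ m) {l : ℝ} (hl : 0 ≤ l)
    (hx : ∀ θ, fusedLassoObj n T v 0 m x ≤ fusedLassoObj n T v 0 m θ) :
    m * columnVariation (fun i t => softThreshold l (x i t))
      ≤ ∑ i, ∑ t, (v i t - x i t) * softThreshold l (x i t) := by
  have h₁ := residual_inner_le hm hx (fun i t => x i t - softThreshold l (x i t))
  have h₂ := le_residual_inner_self hx
  rw [columnVariation_eq_softThreshold_add hl x] at h₂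
  simp only [mul_sub, Finset.sum_sub_distrib] at h₁
  linarith

theorem fusedLassoObj_softThreshold_add_le (hm : 0 ≤ m) {l : ℝ} (hl : 0 ≤ l)
    (hx : ∀ θ, fusedLassoObj n T v 0 m x ≤ fusedLassoObj n T v 0 m θ)
    (θ : Fin n → Fin T → ℝ) :
    fusedLassoObj n T v l m (fun i t => softThreshold l (x i t))
      + (1 / 2) * ∑ i, ∑ t, (θ i t - softThreshold l (x i t)) ^ 2
      ≤ fusedLassoObj n T v l m θ := by
  have h₁ := residual_inner_le hm hx θ
  have h₂ := le_residual_inner_softThreshold hm hl hx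
  have h₃ : (1 / 2) * (∑ i, ∑ t, (softThreshold l (x i t) - v i t) ^ 2)
      + l * (∑ i, ∑ t, |softThreshold l (x i t)|)
      + (1 / 2) * (∑ i, ∑ t, (θ i t - softThreshold l (x i t)) ^ 2)
      + (∑ i, ∑ t, (v i t - x i t) * softThreshold l (x i t))
      ≤ (1 / 2) * (∑ i, ∑ t, (θ i t - v i t) ^ 2) + l * (∑ i, ∑ t, |θ i t|)
      + ∑ i, ∑ t, (v i t - x i t) * θ i t := by
    simp only [Finset.mul_sum, ← Finset.sum_add_distrib]
    refine Finset.sum_le_sum fun i _ => Finset.sum_le_sum fun t _ => ?_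
    have h₄ := sub_softThreshold_mul_self hl (x i t)
    have h₅ : (x i t - softThreshold l (x i t)) * θ i t ≤ l * |θ i t| := by
      refine (le_abs_self _).trans ?_
      rw [abs_mul]
      exact mul_le_mul_of_nonneg_right (abs_sub_softThreshold_le hl _) (abs_nonneg _)
    linarith
  rw [fusedLassoObj_eq, fusedLassoObj_eq]
  linarith

end Minimizer

/-- Proposition 3: the fused-LASSO solution with sparsity parameter `λ₁` is the entrywise
soft-thresholding at level `λ₁` of the solution with `λ₁ = 0`. -/
theorem stmt_12 (n T : ℕ) (hn : 1 ≤ n) (hT : 1 ≤ T) (v : Fin n → Fin T → ℝ)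
    (lam₁ lam₂ : ℝ) (hlam₁ : 0 ≤ lam₁) (hlam₂ : 0 ≤ lam₂)
    (θhat : Fin n → Fin T → ℝ) (θhat0 : Fin n → Fin T → ℝ)
    (hθhat : ∀ θ : Fin n → Fin T → ℝ,
      fusedLassoObj n T v lam₁ lam₂ θhat ≤ fusedLassoObj n T v lam₁ lam₂ θ)
    (hθhat0 : ∀ θ : Fin n → Fin T → ℝ,
      fusedLassoObj n T v 0 lam₂ θhat0 ≤ fusedLassoObj n T v 0 lam₂ θ) :
    ∀ (i : Fin n) (t : Fin T),
      θhat i t = Real.sign (θhat0 i t) * max (|θhat0 i t| - lam₁) 0 := by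
  have h := fusedLassoObj_softThreshold_add_le hlam₂ hlam₁ hθhat0 θhat
  have h' := hθhat (fun i t => softThreshold lam₁ (θhat0 i t))
  intro i t
  have h₁ : (θhat i t - softThreshold lam₁ (θhat0 i t)) ^ 2
      ≤ ∑ i, ∑ t, (θhat i t - softThreshold lam₁ (θhat0 i t)) ^ 2 :=
    (Finset.single_le_sum (f := fun t => (θhat i t - softThreshold lam₁ (θhat0 i t)) ^ 2)
      (fun t _ => sq_nonneg _) (Finset.mem_univ t)).trans
    (Finset.single_le_sum
      (f := fun i => ∑ t, (θhat i t - softThreshold lam₁ (θhat0 i t)) ^ 2)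
      (fun i _ => Finset.sum_nonneg fun t _ => sq_nonneg _) (Finset.mem_univ i))
  change θhat i t = softThreshold lam₁ (θhat0 i t)
  exact sub_eq_zero.1 (pow_eq_zero_iff two_ne_zero |>.1
    (le_antisymm (by linarith) (sq_nonneg _)))
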